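/- arXiv:2407.21722 — 2 statements merged into one kernel-verified Lean document; each statement's English description precedes it below -/
import Mathlib

section
/- Let j ∈ ℤ, A ≥ 0, f ∈ E_A, m ∈ ℕ and n > (m+1)A. Then the iterative combination equals a linear combination of the operators: (I − (I − S_{n,j})^{m+1}) f = Σ_{i=0}^{m} (−1)^i · binom(m+1, i+1) · S_{n/(i+1), j} f, where I denotes the identity operator. -/
open MeasureTheory Real Filter Asymptotics

/-- The basis functions `s_{n,k}(x) = (nx)^k / k! · e^{-nx}` for `k ≥ 0`, and `0` for `k < 0`. -/
noncomputable def szk (n : ℝ) (k : ℤ) (x : ℝ) : ℝ :=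
  if k < 0 then 0 else (n * x) ^ k.toNat / (Nat.factorial k.toNat) * Real.exp (-n * x)

/-- Membership in `E_A`: locally integrable on `[0,∞)` and `|f t| ≤ K e^{A t}` for some `K > 0`. -/
def MemEA (A : ℝ) (f : ℝ → ℝ) : Prop :=
  LocallyIntegrableOn f (Set.Ici 0) volume ∧ ∃ K > 0, ∀ t ≥ (0:ℝ), |f t| ≤ K * Real.exp (A * t)

/-- The Szász-Mirakjan-Durrmeyer type operator `S_{n,j}`. -/
noncomputable def Snj (n : ℝ) (j : ℤ) (f : ℝ → ℝ) (x : ℝ) : ℝ :=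
  f 0 * ∑ k ∈ Finset.range j.toNat, szk n k x
    + ∑' k : ℕ, szk n (max 0 j + k) x *
        (n * ∫ t in Set.Ioi (0:ℝ), szk n (max 0 j + k - j) t * f t)

open ProbabilityTheory
open scoped ENNReal

/-- The Poisson weight `lam ^ k / k! * exp (-lam)`. -/
noncomputable def poissonWeight (lam : ℝ) (k : ℕ) : ℝ :=
  lam ^ k / (Nat.factorial k) * Real.exp (-lam)

lemma szk_natCast (n : ℝ) (k : ℕ) (x : ℝ) : szk n k x = poissonWeight (n * x) k := by
  simp [szk, poissonWeight]

lemma poissonWeight_nonneg {lam : ℝ} (h : 0 ≤ lam) (k : ℕ) : 0 ≤ poissonWeight lam k := by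
  unfold poissonWeight; positivity

@[fun_prop]
lemma measurable_poissonWeight (k : ℕ) : Measurable fun lam => poissonWeight lam k := by
  unfold poissonWeight; fun_prop

lemma hasSum_poissonWeight (lam : ℝ) : HasSum (poissonWeight lam) 1 := by
  have h := (NormedSpace.expSeries_div_hasSum_exp (𝔸 := ℝ) lam).mul_right (Real.exp (-lam))
  rw [← Real.exp_eq_exp_ℝ, ← Real.exp_add, add_neg_cancel, Real.exp_zero] at h
  exact h

lemma tsum_ofReal_poissonWeight {lam : ℝ} (h : 0 ≤ lam) :
    ∑' k, ENNReal.ofReal (poissonWeight lam k) = 1 := by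
  rw [← ENNReal.ofReal_tsum_of_nonneg (poissonWeight_nonneg h) (hasSum_poissonWeight lam).summable,
    (hasSum_poissonWeight lam).tsum_eq, ENNReal.ofReal_one]

/-- Poisson thinning. -/
lemma poissonWeight_add_mul_choose (lam p q : ℝ) (hpq : p + q = 1) (i k : ℕ) :
    poissonWeight lam (i + k) * (Nat.choose (i + k) i) * q ^ i * p ^ k
      = poissonWeight (q * lam) i * poissonWeight (p * lam) k := by
  have hexp : Real.exp (-lam) = Real.exp (-(q * lam)) * Real.exp (-(p * lam)) := by
    rw [← Real.exp_add]; congr 1; linear_combination lam * hpq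
  have hc : ((Nat.choose (i + k) i : ℕ) : ℝ) * (i.factorial * k.factorial) = (i + k).factorial := by
    have := Nat.add_choose_mul_factorial_mul_factorial i k
    rw [← Nat.choose_symm_add] at this
    rw [← mul_assoc]; exact_mod_cast this
  unfold poissonWeight
  rw [hexp]
  have h3 : ((i + k).factorial : ℝ) ≠ 0 := by positivity
  field_simp
  rw [← hc]
  ring

lemma choose_add_add_eq_sum (M N k l : ℕ) (h : M = 0 ∨ N = 0) :
    Nat.choose (M + k + (N + l)) (M + l) = ∑ r ∈ Finset.range (l + 1),
      if r ≤ k then Nat.choose (M + k) (M + r) * Nat.choose (N + l) (N + r) else 0 := by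
  rcases h with rfl | rfl
  · rw [Nat.add_choose_eq, zero_add, zero_add, Finset.Nat.sum_antidiagonal_eq_sum_range_succ_mk]
    refine Finset.sum_congr rfl fun r hr => ?_
    have hr : r ≤ l := by simpa [Nat.lt_succ_iff] using hr
    split_ifs with h
    · rw [zero_add, ← Nat.choose_symm (n := N + l) (k := N + r) (by omega)]
      (congr 2; omega)
    · rw [Nat.choose_eq_zero_of_lt (by omega)]; simp
  · rw [zero_add, add_comm (M + k) l, ← Nat.choose_symm (by omega), Nat.add_choose_eq,
      show l + (M + k) - (M + l) = k by omega,
      Finset.Nat.sum_antidiagonal_eq_sum_range_succ_mk]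
    simp only [← Finset.sum_filter]
    symm
    refine Finset.sum_subset_zero_on_sdiff (fun r => ?_) (fun r hr => ?_) (fun r hr => ?_)
    · simp
    · simp only [Finset.mem_sdiff, Finset.mem_range, Finset.mem_filter] at hr
      rw [Nat.choose_eq_zero_of_lt (by omega), zero_mul]
    · simp only [Finset.mem_range, Finset.mem_filter] at hr
      rw [← Nat.choose_symm (n := M + k) (k := M + r) (by omega), zero_add, mul_comm]
      (congr 2; omega)

lemma tsum_ite_le_sub (r : ℕ) (h : ℕ → ℝ≥0∞) :
    ∑' k, (if r ≤ k then h (k - r) else 0) = ∑' k, h k := by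
  have := ENNReal.summable.sum_add_tsum_nat_add' (f := fun k => if r ≤ k then h (k - r) else 0)
    (k := r)
  rw [← this, Finset.sum_eq_zero, zero_add]
  · simp
  · intro k hk
    simp at hk
    simp [hk]

lemma poissonWeight_mul_choose_mul (M N k l : ℕ) (h : M = 0 ∨ N = 0) (p q y u b : ℝ)
    (hpq : p + q = 1) :
    poissonWeight y (M + k) * ((Nat.choose (M + k + (N + l)) (M + l) * p ^ (N + k + 1)
        * q ^ (M + l)) * (b * poissonWeight u (N + l)))
      = ∑ r ∈ Finset.range (l + 1), (poissonWeight (q * y) (M + r) *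
          (p * b * poissonWeight (p * u) (N + r))) *
          ((if r ≤ k then poissonWeight (p * y) (k - r) else 0) *
          (if r ≤ l then poissonWeight (q * u) (l - r) else 0)) := by
  rw [choose_add_add_eq_sum M N k l h]
  push_cast
  simp only [Finset.sum_mul, Finset.mul_sum]
  refine Finset.sum_congr rfl fun r hr => ?_
  have hr : r ≤ l := by simpa [Nat.lt_succ_iff] using hr
  split_ifs with hk
  · obtain ⟨k, rfl⟩ := Nat.exists_eq_add_of_le hk
    obtain ⟨l, rfl⟩ := Nat.exists_eq_add_of_le hr
    have h1 := poissonWeight_add_mul_choose y p q hpq (M + r) k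
    have h2 := poissonWeight_add_mul_choose u q p (by rw [add_comm, hpq]) (N + r) l
    simp only [Nat.add_sub_cancel_left, ← add_assoc] at *
    linear_combination (poissonWeight (q * u) l * poissonWeight (p * u) (N + r) * p * b) * h1
      + p * b * (poissonWeight y (M + r + k) * (Nat.choose (M + r + k) (M + r)) * q ^ (M + r)
        * p ^ k) * h2
  · simp

lemma tsum_tsum_poissonWeight (M N : ℕ) (h : M = 0 ∨ N = 0) {p q y u b : ℝ} (hp : 0 ≤ p)
    (hq : 0 ≤ q) (hy : 0 ≤ y) (hu : 0 ≤ u) (hb : 0 ≤ b) (hpq : p + q = 1) :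
    ∑' k, ∑' l, ENNReal.ofReal (poissonWeight y (M + k)) *
        (ENNReal.ofReal (Nat.choose (M + k + (N + l)) (M + l) * p ^ (N + k + 1) * q ^ (M + l)) *
          ENNReal.ofReal (b * poissonWeight u (N + l)))
      = ∑' r, ENNReal.ofReal (poissonWeight (q * y) (M + r)) *
          ENNReal.ofReal (p * b * poissonWeight (p * u) (N + r)) := by
  have hw := fun {lam : ℝ} (h : 0 ≤ lam) (k : ℕ) => poissonWeight_nonneg h k
  have key : ∀ k l, ENNReal.ofReal (poissonWeight y (M + k)) *
        (ENNReal.ofReal (Nat.choose (M + k + (N + l)) (M + l) * p ^ (N + k + 1) * q ^ (M + l)) *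
          ENNReal.ofReal (b * poissonWeight u (N + l)))
      = ∑' r, ENNReal.ofReal (poissonWeight (q * y) (M + r)) *
          ENNReal.ofReal (p * b * poissonWeight (p * u) (N + r)) *
          ((if r ≤ k then ENNReal.ofReal (poissonWeight (p * y) (k - r)) else 0) *
          (if r ≤ l then ENNReal.ofReal (poissonWeight (q * u) (l - r)) else 0)) := by
    intro k l
    rw [← ENNReal.ofReal_mul (by positivity), ← ENNReal.ofReal_mul (hw hy _),
      poissonWeight_mul_choose_mul M N k l h p q y u b hpq, tsum_eq_sum (s := Finset.range (l + 1)),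
      ENNReal.ofReal_sum_of_nonneg]
    · refine Finset.sum_congr rfl fun r _ => ?_
      have h1 := hw (mul_nonneg hq hy) (M + r)
      have h2 := hw (mul_nonneg hp hu) (N + r)
      have h3 : 0 ≤ if r ≤ k then poissonWeight (p * y) (k - r) else 0 := by
        split_ifs; exacts [hw (mul_nonneg hp hy) _, le_rfl]
      rw [ENNReal.ofReal_mul (by positivity), ENNReal.ofReal_mul h1, ENNReal.ofReal_mul h3]
      simp only [apply_ite ENNReal.ofReal, ENNReal.ofReal_zero]
    · intro r _
      have h1 := hw (mul_nonneg hq hy) (M + r)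
      have h2 := hw (mul_nonneg hp hu) (N + r)
      have h3 := hw (mul_nonneg hp hy) (k - r)
      have h4 := hw (mul_nonneg hq hu) (l - r)
      split_ifs <;> positivity
    · intro r hr
      have : ¬ r ≤ l := by simp at hr; omega
      simp [this]
  simp_rw [key]
  have swap : ∀ F : ℕ → ℕ → ℕ → ℝ≥0∞, ∑' k, ∑' l, ∑' r, F k l r = ∑' r, ∑' k, ∑' l, F k l r := by
    intro F
    rw [ENNReal.tsum_comm (f := fun r k => ∑' l, F k l r)]
    exact tsum_congr fun k => ENNReal.tsum_comm
  rw [swap]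
  refine tsum_congr fun r => ?_
  simp_rw [ENNReal.tsum_mul_left, ENNReal.tsum_mul_right]
  rw [tsum_ite_le_sub r fun k => ENNReal.ofReal (poissonWeight (p * y) k),
    tsum_ite_le_sub r fun k => ENNReal.ofReal (poissonWeight (q * u) k),
    tsum_ofReal_poissonWeight (by positivity), tsum_ofReal_poissonWeight (by positivity)]
  simp

lemma lintegral_pow_mul_exp_neg_mul {r : ℝ} (hr : 0 < r) (i : ℕ) :
    ∫⁻ t in Set.Ioi (0 : ℝ), ENNReal.ofReal (t ^ i * Real.exp (-(r * t)))
      = ENNReal.ofReal (i.factorial / r ^ (i + 1)) := by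
  have h := Real.integral_rpow_mul_exp_neg_mul_Ioi (a := i + 1) (by positivity) hr
  rw [Real.Gamma_nat_eq_factorial] at h
  simp only [add_sub_cancel_right, Real.rpow_natCast] at h
  have e : (1 / r) ^ ((i : ℝ) + 1) * i.factorial = i.factorial / r ^ (i + 1) := by
    rw [show (i : ℝ) + 1 = ((i + 1 : ℕ) : ℝ) by push_cast; rfl, Real.rpow_natCast,
      one_div, inv_pow, inv_mul_eq_div]
  rw [e] at h
  rw [← h, MeasureTheory.ofReal_integral_eq_lintegral_ofReal]
  · by_contra hc
    rw [integral_undef hc] at h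
    have : (0 : ℝ) < i.factorial / r ^ (i + 1) := by positivity
    exact this.ne h
  · filter_upwards [ae_restrict_mem measurableSet_Ioi] with t ht
    have : (0 : ℝ) < t := ht
    simp only [Pi.zero_apply]
    positivity

lemma lintegral_poissonWeight_mul_poissonWeight {a b : ℝ} (ha : 0 < a) (hb : 0 < b) (i l : ℕ) :
    ∫⁻ t in Set.Ioi (0 : ℝ), ENNReal.ofReal (a * poissonWeight (a * t) i) *
        ENNReal.ofReal (poissonWeight (b * t) l)
      = ENNReal.ofReal (Nat.choose (l + i) l * (a / (a + b)) ^ (i + 1) * (b / (a + b)) ^ l) := by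
  have hab : 0 < a + b := by positivity
  have h : ∀ t ∈ Set.Ioi (0 : ℝ), ENNReal.ofReal (a * poissonWeight (a * t) i) *
        ENNReal.ofReal (poissonWeight (b * t) l)
      = ENNReal.ofReal (a ^ (i + 1) * b ^ l / (i.factorial * l.factorial)) *
        ENNReal.ofReal (t ^ (l + i) * Real.exp (-((a + b) * t))) := by
    intro t ht
    have ht : (0 : ℝ) < t := ht
    have h1 := poissonWeight_nonneg (mul_pos ha ht).le i
    rw [← ENNReal.ofReal_mul (by positivity), ← ENNReal.ofReal_mul (by positivity)]
    congr 1
    have hexp : Real.exp (-((a + b) * t)) = Real.exp (-(a * t)) * Real.exp (-(b * t)) := by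
      rw [← Real.exp_add]; congr 1; ring
    rw [hexp]
    unfold poissonWeight
    field_simp
    ring
  rw [setLIntegral_congr_fun measurableSet_Ioi h, lintegral_const_mul _ (by fun_prop),
    lintegral_pow_mul_exp_neg_mul hab, ← ENNReal.ofReal_mul (by positivity)]
  congr 1
  have hc : ((Nat.choose (l + i) l : ℕ) : ℝ) * l.factorial * i.factorial = (l + i).factorial := by
    have := Nat.add_choose_mul_factorial_mul_factorial l i
    rw [← Nat.choose_symm_add] at this
    exact_mod_cast this
  rw [← hc, div_pow, div_pow, show l + i + 1 = i + 1 + l by omega, pow_add (a + b)]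
  field_simp

/-- The Gamma distribution with density `n * poissonWeight (n * t) i` on `(0, ∞)`. -/
noncomputable def poissonGamma (n : ℝ) (i : ℕ) : Measure ℝ :=
  (volume.restrict (Set.Ioi 0)).withDensity fun t => ENNReal.ofReal (n * poissonWeight (n * t) i)

lemma lintegral_poissonGamma (n : ℝ) (i : ℕ) {g : ℝ → ℝ≥0∞} (hg : Measurable g) :
    ∫⁻ t, g t ∂poissonGamma n i
      = ∫⁻ t in Set.Ioi 0, ENNReal.ofReal (n * poissonWeight (n * t) i) * g t := by
  rw [poissonGamma, lintegral_withDensity_eq_lintegral_mul _ (by fun_prop) hg]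
  rfl

lemma integral_poissonGamma {n : ℝ} (hn : 0 ≤ n) (i : ℕ) (f : ℝ → ℝ) :
    ∫ t, f t ∂poissonGamma n i = n * ∫ t in Set.Ioi 0, poissonWeight (n * t) i * f t := by
  rw [poissonGamma, integral_withDensity_eq_integral_toReal_smul (by fun_prop) (by simp),
    ← integral_const_mul]
  refine setIntegral_congr_fun measurableSet_Ioi fun t ht => ?_
  have h1 := poissonWeight_nonneg (mul_nonneg hn (le_of_lt ht)) i
  rw [ENNReal.toReal_ofReal (by positivity), smul_eq_mul, mul_assoc]

lemma lintegral_exp_poissonGamma {n A : ℝ} (hn : 0 < n) (hA : A < n) (i : ℕ) :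
    ∫⁻ t, ENNReal.ofReal (Real.exp (A * t)) ∂poissonGamma n i
      = ENNReal.ofReal ((n / (n - A)) ^ (i + 1)) := by
  have h : ∀ t ∈ Set.Ioi (0 : ℝ), ENNReal.ofReal (n * poissonWeight (n * t) i) *
        ENNReal.ofReal (Real.exp (A * t))
      = ENNReal.ofReal (n ^ (i + 1) / i.factorial) *
        ENNReal.ofReal (t ^ i * Real.exp (-((n - A) * t))) := by
    intro t ht
    have h1 := poissonWeight_nonneg (mul_nonneg hn.le (le_of_lt ht)) i
    rw [← ENNReal.ofReal_mul (by positivity), ← ENNReal.ofReal_mul (by positivity)]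
    congr 1
    have hexp : Real.exp (-((n - A) * t)) = Real.exp (-(n * t)) * Real.exp (A * t) := by
      rw [← Real.exp_add]; congr 1; ring
    rw [hexp]
    unfold poissonWeight
    rw [mul_pow]
    ring
  rw [lintegral_poissonGamma _ _ (by fun_prop), setLIntegral_congr_fun measurableSet_Ioi h,
    lintegral_const_mul _ (by fun_prop), lintegral_pow_mul_exp_neg_mul (sub_pos.2 hA),
    ← ENNReal.ofReal_mul (by positivity)]
  congr 1
  have := sub_pos.2 hA
  rw [div_pow]
  field_simp

lemma poissonGamma_univ {n : ℝ} (hn : 0 < n) (i : ℕ) : poissonGamma n i Set.univ = 1 := by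
  have h := lintegral_exp_poissonGamma hn (A := 0) hn i
  simpa [hn.ne'] using h

/-- The absolutely continuous part of the Szász-Mirakjan-Durrmeyer kernel, with `j = M - N`. -/
noncomputable def durrmeyerKernel (M N : ℕ) (n : ℝ) : Kernel ℝ ℝ where
  toFun x := Measure.sum fun k : ℕ =>
    ENNReal.ofReal (poissonWeight (n * x) (M + k)) • poissonGamma n (N + k)
  measurable' := by
    refine Measure.measurable_of_measurable_coe _ fun s hs => ?_
    simp only [Measure.sum_apply _ hs, Measure.smul_apply, smul_eq_mul]
    fun_prop

lemma durrmeyerKernel_apply (M N : ℕ) (n x : ℝ) :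
    durrmeyerKernel M N n x = Measure.sum fun k : ℕ =>
      ENNReal.ofReal (poissonWeight (n * x) (M + k)) • poissonGamma n (N + k) := rfl

lemma lintegral_durrmeyerKernel (M N : ℕ) (n x : ℝ) (g : ℝ → ℝ≥0∞) :
    ∫⁻ t, g t ∂durrmeyerKernel M N n x = ∑' k : ℕ,
      ENNReal.ofReal (poissonWeight (n * x) (M + k)) * ∫⁻ t, g t ∂poissonGamma n (N + k) := by
  simp [durrmeyerKernel_apply, lintegral_sum_measure]

lemma durrmeyerKernel_apply_set (M N : ℕ) (n x : ℝ) {s : Set ℝ} (hs : MeasurableSet s) :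
    durrmeyerKernel M N n x s = ∑' k : ℕ,
      ENNReal.ofReal (poissonWeight (n * x) (M + k)) * poissonGamma n (N + k) s := by
  simp [durrmeyerKernel_apply, Measure.sum_apply _ hs]

lemma ae_pos_durrmeyerKernel (M N : ℕ) (n x : ℝ) : ∀ᵐ t ∂durrmeyerKernel M N n x, 0 < t := by
  rw [durrmeyerKernel_apply, Measure.ae_sum_iff]
  intro k
  refine Measure.ae_smul_measure ?_ _
  exact (withDensity_absolutelyContinuous _ _).ae_le (ae_restrict_mem measurableSet_Ioi)

lemma durrmeyerKernel_comp_apply (M N : ℕ) (h : M = 0 ∨ N = 0) {a b : ℝ} (ha : 0 < a) (hb : 0 < b)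
    {x : ℝ} (hx : 0 ≤ x) :
    (durrmeyerKernel M N b ∘ₖ durrmeyerKernel M N a) x
      = durrmeyerKernel M N (a * b / (a + b)) x := by
  ext s hs
  have hab : 0 < a + b := by positivity
  rw [Kernel.comp_apply' _ _ _ hs, lintegral_durrmeyerKernel, durrmeyerKernel_apply_set _ _ _ _ hs]
  have hin : ∀ k, ∫⁻ t, durrmeyerKernel M N b t s ∂poissonGamma a (N + k)
      = ∑' l, ENNReal.ofReal (Nat.choose (M + k + (N + l)) (M + l) * (a / (a + b)) ^ (N + k + 1)
        * (b / (a + b)) ^ (M + l)) * poissonGamma b (N + l) s := by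
    intro k
    simp_rw [durrmeyerKernel_apply_set _ _ _ _ hs]
    rw [lintegral_tsum (fun l => by fun_prop)]
    refine tsum_congr fun l => ?_
    rw [lintegral_mul_const _ (by fun_prop), lintegral_poissonGamma _ _ (by fun_prop),
      lintegral_poissonWeight_mul_poissonWeight ha hb,
      show M + l + (N + k) = M + k + (N + l) by omega]
  have hG : ∀ c i, poissonGamma c i s = ∫⁻ u in s, ENNReal.ofReal (c * poissonWeight (c * u) i)
      ∂(volume.restrict (Set.Ioi 0)) := fun c i => withDensity_apply _ hs
  simp_rw [hin, hG, ← ENNReal.tsum_mul_left]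
  have e : ∀ k l, ENNReal.ofReal (poissonWeight (a * x) (M + k)) *
      (ENNReal.ofReal (Nat.choose (M + k + (N + l)) (M + l) * (a / (a + b)) ^ (N + k + 1)
        * (b / (a + b)) ^ (M + l)) * ∫⁻ u in s, ENNReal.ofReal (b * poissonWeight (b * u) (N + l))
          ∂(volume.restrict (Set.Ioi 0)))
      = ∫⁻ u in s, ENNReal.ofReal (poissonWeight (a * x) (M + k)) *
      (ENNReal.ofReal (Nat.choose (M + k + (N + l)) (M + l) * (a / (a + b)) ^ (N + k + 1)
        * (b / (a + b)) ^ (M + l)) * ENNReal.ofReal (b * poissonWeight (b * u) (N + l)))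
          ∂(volume.restrict (Set.Ioi 0)) := by
    intro k l
    rw [lintegral_const_mul _ (by fun_prop), lintegral_const_mul _ (by fun_prop)]
  simp_rw [e]
  have e' : ∀ r, ENNReal.ofReal (poissonWeight (a * b / (a + b) * x) (M + r)) *
      ∫⁻ u in s, ENNReal.ofReal (a * b / (a + b) * poissonWeight (a * b / (a + b) * u) (N + r))
        ∂(volume.restrict (Set.Ioi 0))
      = ∫⁻ u in s, ENNReal.ofReal (poissonWeight (a * b / (a + b) * x) (M + r)) *
        ENNReal.ofReal (a * b / (a + b) * poissonWeight (a * b / (a + b) * u) (N + r))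
        ∂(volume.restrict (Set.Ioi 0)) := by
    intro r
    rw [lintegral_const_mul _ (by fun_prop)]
  simp_rw [e']
  rw [← lintegral_tsum (fun r => by fun_prop)]
  have e'' : ∀ k, ∑' l, ∫⁻ u in s, ENNReal.ofReal (poissonWeight (a * x) (M + k)) *
      (ENNReal.ofReal (Nat.choose (M + k + (N + l)) (M + l) * (a / (a + b)) ^ (N + k + 1)
        * (b / (a + b)) ^ (M + l)) * ENNReal.ofReal (b * poissonWeight (b * u) (N + l)))
          ∂(volume.restrict (Set.Ioi 0))
      = ∫⁻ u in s, ∑' l, ENNReal.ofReal (poissonWeight (a * x) (M + k)) *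
      (ENNReal.ofReal (Nat.choose (M + k + (N + l)) (M + l) * (a / (a + b)) ^ (N + k + 1)
        * (b / (a + b)) ^ (M + l)) * ENNReal.ofReal (b * poissonWeight (b * u) (N + l)))
          ∂(volume.restrict (Set.Ioi 0)) :=
    fun k => (lintegral_tsum (fun r => by fun_prop)).symm
  simp_rw [e'']
  rw [← lintegral_tsum (fun r => by fun_prop)]
  refine lintegral_congr_ae (ae_restrict_of_ae ?_)
  filter_upwards [ae_restrict_mem measurableSet_Ioi] with u hu
  have hu : 0 < u := hu
  rw [tsum_tsum_poissonWeight M N h (p := a / (a + b)) (q := b / (a + b)) (by positivity)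
    (by positivity) (by positivity) (by positivity) hb.le (by field_simp)]
  refine tsum_congr fun r => ?_
  rw [show b / (a + b) * (a * x) = a * b / (a + b) * x by ring,
    show a / (a + b) * (b * u) = a * b / (a + b) * u by ring,
    show a / (a + b) * b = a * b / (a + b) by ring]

lemma sum_add_durrmeyerKernel_univ (M N : ℕ) {n : ℝ} (hn : 0 < n) {x : ℝ} (hx : 0 ≤ x) :
    ∑ k ∈ Finset.range M, ENNReal.ofReal (poissonWeight (n * x) k)
      + durrmeyerKernel M N n x Set.univ = 1 := by
  rw [durrmeyerKernel_apply_set _ _ _ _ MeasurableSet.univ]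
  simp_rw [poissonGamma_univ hn, mul_one, add_comm M]
  rw [ENNReal.summable.sum_add_tsum_nat_add'
      (f := fun k => ENNReal.ofReal (poissonWeight (n * x) k)),
    tsum_ofReal_poissonWeight (by positivity)]

lemma isFiniteMeasure_durrmeyerKernel (M N : ℕ) {n : ℝ} (hn : 0 < n) {x : ℝ} (hx : 0 ≤ x) :
    IsFiniteMeasure (durrmeyerKernel M N n x) := by
  refine ⟨lt_of_le_of_lt ?_ ENNReal.one_lt_top⟩
  rw [← sum_add_durrmeyerKernel_univ M N hn hx]
  exact le_add_self

lemma sum_add_durrmeyerKernel_real_univ (M N : ℕ) {n : ℝ} (hn : 0 < n) {x : ℝ} (hx : 0 ≤ x) :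
    ∑ k ∈ Finset.range M, poissonWeight (n * x) k
      + (durrmeyerKernel M N n x).real Set.univ = 1 := by
  have := isFiniteMeasure_durrmeyerKernel M N hn hx
  have h := congrArg ENNReal.toReal (sum_add_durrmeyerKernel_univ M N hn hx)
  rw [ENNReal.toReal_add (by simp) (by simp), ENNReal.toReal_sum (by simp)] at h
  rw [← ENNReal.toReal_one, ← h]
  congr 1
  exact Finset.sum_congr rfl fun k _ =>
    (ENNReal.toReal_ofReal (poissonWeight_nonneg (by positivity) k)).symm

lemma lintegral_exp_durrmeyerKernel_lt_top (M N : ℕ) {n A : ℝ} (hA0 : 0 ≤ A) (hA : A < n) {x : ℝ}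
    (hx : 0 ≤ x) :
    ∫⁻ t, ENNReal.ofReal (Real.exp (A * t)) ∂durrmeyerKernel M N n x < ∞ := by
  have hn : 0 < n := hA0.trans_lt hA
  have hd := sub_pos.2 hA
  set ρ := n / (n - A) with hρ
  have hρ1 : 1 ≤ ρ := by rw [hρ, one_le_div hd]; linarith
  have hw := fun k => poissonWeight_nonneg (mul_nonneg hn.le hx) k
  have hs : Summable fun k => poissonWeight (n * x) k * ρ ^ k := by
    refine ((Real.summable_pow_div_factorial (n * x * ρ)).mul_right (Real.exp (-(n * x)))).congr
      fun k => ?_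
    unfold poissonWeight
    rw [mul_pow]; ring
  have hs' : Summable fun k => ρ ^ (N + 1) * (poissonWeight (n * x) (k + M) * ρ ^ (k + M)) :=
    ((summable_nat_add_iff M).2 hs).mul_left _
  rw [lintegral_durrmeyerKernel]
  simp_rw [lintegral_exp_poissonGamma hn hA]
  refine lt_of_le_of_lt (ENNReal.tsum_le_tsum fun k => ?_) hs'.tsum_ofReal_lt_top
  rw [← ENNReal.ofReal_mul (hw _)]
  refine ENNReal.ofReal_le_ofReal ?_
  calc poissonWeight (n * x) (M + k) * ρ ^ (N + k + 1)
      ≤ poissonWeight (n * x) (M + k) * ρ ^ (N + 1 + (k + M)) :=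
        mul_le_mul_of_nonneg_left (pow_le_pow_right₀ hρ1 (by omega)) (hw _)
    _ = _ := by rw [pow_add, add_comm M k]; ring

lemma MemEA.integrable_durrmeyerKernel {A : ℝ} {f : ℝ → ℝ} (hf : MemEA A f) (hA0 : 0 ≤ A) (M N : ℕ)
    {n : ℝ} (hA : A < n) {x : ℝ} (hx : 0 ≤ x) : Integrable f (durrmeyerKernel M N n x) := by
  obtain ⟨hloc, K, hK, hle⟩ := hf
  have hbd : Integrable (fun t => K * Real.exp (A * t)) (durrmeyerKernel M N n x) := by
    refine Integrable.const_mul ⟨by fun_prop, ?_⟩ K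
    rw [hasFiniteIntegral_iff_ofReal (ae_of_all _ fun t => (Real.exp_pos _).le)]
    exact lintegral_exp_durrmeyerKernel_lt_top M N hA0 hA hx
  refine hbd.mono' ?_ ?_
  · rw [durrmeyerKernel_apply, aestronglyMeasurable_sum_measure_iff]
    intro k
    refine AEStronglyMeasurable.smul_measure ?_ _
    exact (hloc.aestronglyMeasurable.mono_measure
      (Measure.restrict_mono Set.Ioi_subset_Ici_self le_rfl)).mono_ac
        (withDensity_absolutelyContinuous _ _)
  · filter_upwards [ae_pos_durrmeyerKernel M N n x] with t ht using hle t ht.le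

lemma Snj_eq_sum_add_integral {n : ℝ} (hn : 0 < n) (j : ℤ) {f : ℝ → ℝ} {x : ℝ} (hx : 0 ≤ x)
    (hf : Integrable f (durrmeyerKernel j.toNat (-j).toNat n x)) :
    Snj n j f x = f 0 * ∑ k ∈ Finset.range j.toNat, poissonWeight (n * x) k
      + ∫ t, f t ∂durrmeyerKernel j.toNat (-j).toNat n x := by
  have hM : ∀ k : ℕ, max 0 j + (k : ℤ) = ((j.toNat + k : ℕ) : ℤ) := by intro k; omega
  have hN : ∀ k : ℕ, ((j.toNat + k : ℕ) : ℤ) - j = (((-j).toNat + k : ℕ) : ℤ) := by intro k; omega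
  rw [durrmeyerKernel_apply] at hf ⊢
  rw [← (hasSum_integral_measure hf).tsum_eq, Snj]
  simp_rw [hM, hN, szk_natCast, integral_smul_measure, integral_poissonGamma hn.le, smul_eq_mul,
    ENNReal.toReal_ofReal (poissonWeight_nonneg (mul_nonneg hn.le hx) _)]

lemma Snj_eq_add_integral_sub {n : ℝ} (hn : 0 < n) (j : ℤ) {f : ℝ → ℝ} {x : ℝ} (hx : 0 ≤ x)
    (hf : Integrable f (durrmeyerKernel j.toNat (-j).toNat n x)) :
    Snj n j f x = f 0 + ∫ t, (f t - f 0) ∂durrmeyerKernel j.toNat (-j).toNat n x := by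
  have := isFiniteMeasure_durrmeyerKernel j.toNat (-j).toNat hn hx
  have h1 := sum_add_durrmeyerKernel_real_univ j.toNat (-j).toNat hn hx
  rw [Snj_eq_sum_add_integral hn j hx hf, integral_sub hf (integrable_const _), integral_const,
    smul_eq_mul]
  linear_combination f 0 * h1

lemma Snj_zero_of_pos (n : ℝ) {j : ℤ} (hj : 0 < j) (f : ℝ → ℝ) : Snj n j f 0 = f 0 := by
  have hM : ∀ k : ℕ, max 0 j + (k : ℤ) = ((j.toNat + k : ℕ) : ℤ) := by intro k; omega
  have hM0 : ∀ k, j.toNat + k ≠ 0 := by intro k; omega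
  have hw : ∀ k, poissonWeight 0 k = if k = 0 then 1 else 0 := by
    intro k
    rcases eq_or_ne k 0 with rfl | hk
    · simp [poissonWeight]
    · simp [poissonWeight, hk]
  simp_rw [Snj, hM, szk_natCast, mul_zero, hw, hM0]
  simp [hj]

lemma Snj_congr (n : ℝ) (j : ℤ) {f g : ℝ → ℝ} (h : ∀ t ≥ (0 : ℝ), f t = g t) :
    Snj n j f = Snj n j g := by
  funext x
  unfold Snj
  rw [h 0 le_rfl]
  congr 1
  refine tsum_congr fun k => ?_
  congr 2
  exact setIntegral_congr_fun measurableSet_Ioi fun t ht => by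
    simp only [h t (le_of_lt ht)]

lemma Snj_sum {n : ℝ} (hn : 0 < n) (j : ℤ) {ι : Type*} (s : Finset ι) (c : ι → ℝ)
    (V : ι → ℝ → ℝ) {x : ℝ} (hx : 0 ≤ x)
    (hV : ∀ i ∈ s, Integrable (V i) (durrmeyerKernel j.toNat (-j).toNat n x)) :
    Snj n j (fun t => ∑ i ∈ s, c i * V i t) x = ∑ i ∈ s, c i * Snj n j (V i) x := by
  have hc := fun i hi => (hV i hi).const_mul (c i)
  rw [Snj_eq_sum_add_integral hn j hx (integrable_finsetSum s hc), integral_finsetSum s hc,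
    Finset.sum_mul, ← Finset.sum_add_distrib]
  refine Finset.sum_congr rfl fun i hi => ?_
  rw [Snj_eq_sum_add_integral hn j hx (hV i hi), integral_const_mul]
  ring

section Composition

variable {a b : ℝ} {j : ℤ} {f : ℝ → ℝ} {x : ℝ}

lemma Snj_ae_eq (hb : 0 < b)
    (hfb : ∀ t ≥ (0 : ℝ), Integrable f (durrmeyerKernel j.toNat (-j).toNat b t)) :
    Snj b j f =ᵐ[durrmeyerKernel j.toNat (-j).toNat a x] fun t =>
      f 0 + ∫ u, (f u - f 0) ∂durrmeyerKernel j.toNat (-j).toNat b t := by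
  filter_upwards [ae_pos_durrmeyerKernel j.toNat (-j).toNat a x] with t ht using
    Snj_eq_add_integral_sub hb j ht.le (hfb t ht.le)

lemma integrable_sub_comp_durrmeyerKernel (ha : 0 < a) (hb : 0 < b) (hx : 0 ≤ x)
    (hfc : Integrable f (durrmeyerKernel j.toNat (-j).toNat (a * b / (a + b)) x)) :
    Integrable (fun u => f u - f 0) ((durrmeyerKernel j.toNat (-j).toNat b ∘ₖ
      durrmeyerKernel j.toNat (-j).toNat a) x) := by
  rw [durrmeyerKernel_comp_apply _ _ (by omega) ha hb hx]
  have := isFiniteMeasure_durrmeyerKernel j.toNat (-j).toNat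
    (show 0 < a * b / (a + b) by positivity) hx
  exact hfc.sub (integrable_const _)

lemma integrable_Snj_durrmeyerKernel (ha : 0 < a) (hb : 0 < b) (hx : 0 ≤ x)
    (hfb : ∀ t ≥ (0 : ℝ), Integrable f (durrmeyerKernel j.toNat (-j).toNat b t))
    (hfc : Integrable f (durrmeyerKernel j.toNat (-j).toNat (a * b / (a + b)) x)) :
    Integrable (Snj b j f) (durrmeyerKernel j.toNat (-j).toNat a x) := by
  have := isFiniteMeasure_durrmeyerKernel j.toNat (-j).toNat ha hx
  rw [integrable_congr (Snj_ae_eq hb hfb)]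
  exact (integrable_const _).add (integrable_sub_comp_durrmeyerKernel ha hb hx hfc).integral_comp

lemma Snj_Snj (ha : 0 < a) (hb : 0 < b) (hx : 0 ≤ x)
    (hfb : ∀ t ≥ (0 : ℝ), Integrable f (durrmeyerKernel j.toNat (-j).toNat b t))
    (hfc : Integrable f (durrmeyerKernel j.toNat (-j).toNat (a * b / (a + b)) x)) :
    Snj a j (Snj b j f) x = Snj (a * b / (a + b)) j f x := by
  have hfin := isFiniteMeasure_durrmeyerKernel j.toNat (-j).toNat ha hx
  have hint := integrable_sub_comp_durrmeyerKernel ha hb hx hfc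
  have hS := integrable_Snj_durrmeyerKernel ha hb hx hfb hfc
  have h1 := sum_add_durrmeyerKernel_real_univ j.toNat (-j).toNat ha hx
  have h0 : Snj b j f 0 * ∑ k ∈ Finset.range j.toNat, poissonWeight (a * x) k
      = f 0 * ∑ k ∈ Finset.range j.toNat, poissonWeight (a * x) k := by
    rcases lt_or_ge 0 j with hj | hj
    · rw [Snj_zero_of_pos b hj]
    · simp [Int.toNat_of_nonpos hj]
  rw [Snj_eq_sum_add_integral ha j hx hS, h0, integral_congr_ae (Snj_ae_eq hb hfb),
    integral_add (integrable_const _) hint.integral_comp, ← Kernel.integral_comp hint,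
    durrmeyerKernel_comp_apply _ _ (by omega) ha hb hx, integral_const, smul_eq_mul,
    Snj_eq_add_integral_sub (by positivity) j hx hfc]
  linear_combination f 0 * h1

end Composition

lemma sum_choose_succ_alternating (V : ℕ → ℝ) (k : ℕ) :
    ∑ i ∈ Finset.range (k + 2), (-1 : ℝ) ^ i * (Nat.choose (k + 1) i) * V i
      = ∑ i ∈ Finset.range (k + 1), (-1 : ℝ) ^ i * (Nat.choose k i) * V i
        - ∑ i ∈ Finset.range (k + 1), (-1 : ℝ) ^ i * (Nat.choose k i) * V (i + 1) := by
  have h : ∑ i ∈ Finset.range (k + 1), (-1 : ℝ) ^ i * (Nat.choose k i) * V i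
      = ∑ i ∈ Finset.range (k + 2), (-1 : ℝ) ^ i * (Nat.choose k i) * V i := by
    rw [Finset.sum_range_succ _ (k + 1)]; simp
  rw [h, Finset.sum_range_succ', Finset.sum_range_succ' _ (k + 1), add_sub_right_comm,
    ← Finset.sum_sub_distrib]
  congr 1
  · refine Finset.sum_congr rfl fun i _ => ?_
    rw [Nat.choose_succ_succ]
    push_cast
    ring
  · simp

/-- The powers of `S_{n,j}` applied to `f`: `f` itself, then `S_{n/i,j} f`. -/
noncomputable def snjPower (n : ℝ) (j : ℤ) (f : ℝ → ℝ) : ℕ → ℝ → ℝ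
  | 0 => f
  | i + 1 => Snj (n / (i + 1)) j f

lemma iterate_sub_Snj_apply {n : ℝ} (hn : 0 < n) {j : ℤ} {f : ℝ → ℝ} {m : ℕ}
    (hint : ∀ i ≤ m, ∀ t ≥ (0 : ℝ),
      Integrable f (durrmeyerKernel j.toNat (-j).toNat (n / (i + 1)) t)) :
    ∀ k ≤ m + 1, ∀ x ≥ (0 : ℝ), ((fun g : ℝ → ℝ => g - Snj n j g)^[k] f) x
      = ∑ i ∈ Finset.range (k + 1), (-1 : ℝ) ^ i * (Nat.choose k i) * snjPower n j f i x := by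
  have hc : ∀ i : ℕ, n * (n / (i + 1)) / (n + n / (i + 1)) = n / ((i + 1 : ℕ) + 1) := by
    intro i; push_cast; field_simp
  have hgood : ∀ i ≤ m, ∀ x ≥ (0 : ℝ),
      Integrable (snjPower n j f i) (durrmeyerKernel j.toNat (-j).toNat n x) := by
    rintro (_ | i) hi x hx
    · simpa [snjPower] using hint 0 hi x hx
    · exact integrable_Snj_durrmeyerKernel hn (by positivity) hx (hint i (by omega))
        (by rw [hc]; exact hint (i + 1) hi x hx)
  have hstep : ∀ i ≤ m, ∀ x ≥ (0 : ℝ),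
      Snj n j (snjPower n j f i) x = snjPower n j f (i + 1) x := by
    rintro (_ | i) hi x hx
    · simp [snjPower]
    · simp only [snjPower]
      rw [← hc]
      exact Snj_Snj hn (by positivity) hx (hint i (by omega))
        (by rw [hc]; exact hint (i + 1) hi x hx)
  intro k
  induction k with
  | zero => intro _ x _; simp [snjPower]
  | succ k ih =>
    intro hk x hx
    have ih := ih (by omega)
    rw [Function.iterate_succ_apply', Pi.sub_apply, Snj_congr n j ih, ih x hx,
      Snj_sum hn j _ _ _ hx fun i hi => hgood i (by simp at hi; omega) x hx,
      sum_choose_succ_alternating fun i => snjPower n j f i x]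
    congr 1
    refine Finset.sum_congr rfl fun i hi => ?_
    rw [hstep i (by simp at hi; omega) x hx]

/-- Iterative combinations are linear combinations:
`(I - (I - S_{n,j})^{m+1}) f = Σ_{i=0}^m (-1)^i binom(m+1, i+1) S_{n/(i+1),j} f`. -/
theorem iterative_combination_Snj (j : ℤ) (A : ℝ) (hA : 0 ≤ A) (f : ℝ → ℝ) (hf : MemEA A f)
    (m : ℕ) (n : ℝ) (hn : n > (m + 1) * A) :
    ∀ x ≥ (0:ℝ),
      f x - ((fun g : ℝ → ℝ => g - Snj n j g)^[m + 1] f) x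
        = ∑ i ∈ Finset.range (m + 1),
            (-1 : ℝ) ^ i * (Nat.choose (m + 1) (i + 1)) * Snj (n / (i + 1)) j f x := by
  intro x hx
  have hn0 : 0 < n := lt_of_le_of_lt (by positivity) hn
  have hint : ∀ i ≤ m, ∀ t ≥ (0 : ℝ),
      Integrable f (durrmeyerKernel j.toNat (-j).toNat (n / (i + 1)) t) := by
    intro i hi t ht
    refine hf.integrable_durrmeyerKernel hA _ _ ?_ ht
    rw [lt_div_iff₀ (by positivity), mul_comm]
    have hi : (i : ℝ) ≤ m := by exact_mod_cast hi
    exact lt_of_le_of_lt (by gcongr) hn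
  rw [iterate_sub_Snj_apply hn0 hint (m + 1) le_rfl x hx, Finset.sum_range_succ']
  simp only [snjPower, pow_zero, Nat.choose_zero_right, Nat.cast_one, one_mul]
  rw [sub_add_cancel_right, ← Finset.sum_neg_distrib]
  refine Finset.sum_congr rfl fun i _ => ?_
  ring
end

section
/- Let j ∈ ℤ and let f : [0,∞) → ℝ be twice differentiable with f ∈ E and D_j² f ∈ E; in the case j ≥ 2 assume additionally that f′(0) = 0. Then for all sufficiently large n the operators S_{n,j} and D_j² commute on f: S_{n,j}(D_j² f) = D_j²(S_{n,j} f) on [0,∞). -/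
open MeasureTheory Real Filter Asymptotics

/-- The differential operator `D_j² f = (1-j) f' + e₁ f''`. -/
noncomputable def D2 (j : ℤ) (f : ℝ → ℝ) (x : ℝ) : ℝ :=
  (1 - j) * deriv f x + x * deriv (deriv f) x

/-- The exponential generating function `∑ a_k y^k / k!` of a real sequence. -/
noncomputable def expGen (a : ℕ → ℝ) (y : ℝ) : ℝ := ∑' k : ℕ, a k * (y ^ k / k.factorial)

/-- A real sequence of at most geometric growth. -/
def GeomBdd (a : ℕ → ℝ) : Prop := ∃ C R : ℝ, 0 ≤ C ∧ 0 ≤ R ∧ ∀ k, |a k| ≤ C * R ^ k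

lemma GeomBdd.shift {a : ℕ → ℝ} (ha : GeomBdd a) : GeomBdd fun k => a (k + 1) := by
  obtain ⟨C, R, hC, hR, h⟩ := ha
  refine ⟨C * R, R, by positivity, hR, fun k => (h (k + 1)).trans_eq (by ring)⟩

lemma GeomBdd.summable {a : ℕ → ℝ} (ha : GeomBdd a) (y : ℝ) :
    Summable fun k : ℕ => a k * (y ^ k / k.factorial) := by
  obtain ⟨C, R, hC, hR, h⟩ := ha
  refine Summable.of_norm_bounded ((Real.summable_pow_div_factorial (R * |y|)).mul_left C) fun k => ?_
  rw [norm_mul, norm_div, norm_pow, Real.norm_eq_abs, Real.norm_eq_abs, Real.norm_natCast,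
    mul_pow]
  calc |a k| * (|y| ^ k / k.factorial) ≤ C * R ^ k * (|y| ^ k / k.factorial) := by
        gcongr; exact h k
    _ = _ := by ring

lemma succ_mul_pow_div_factorial (y : ℝ) (k : ℕ) :
    ((k : ℝ) + 1) * (y ^ k / (k + 1).factorial) = y ^ k / k.factorial := by
  rw [Nat.factorial_succ]
  push_cast
  have := k.factorial_pos
  field_simp

lemma hasDerivAt_expGen {a : ℕ → ℝ} (ha : GeomBdd a) (y : ℝ) :
    HasDerivAt (expGen a) (expGen (fun k => a (k + 1)) y) y := by
  have ha' := ha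
  obtain ⟨C, R, hC, hR, h⟩ := ha
  set M := |y| + 1 with hM
  have key : ∀ z : ℝ, ∀ k : ℕ, a (k + 1) * (((k + 1 : ℕ) : ℝ) * z ^ (k + 1 - 1) / (k + 1).factorial)
      = a (k + 1) * (z ^ k / k.factorial) := fun z k => by
    rw [← succ_mul_pow_div_factorial z k]; push_cast; simp [mul_div_assoc]
  set u : ℕ → ℝ := fun k => |a k * ((k : ℝ) * M ^ (k - 1) / k.factorial)| with hu
  have husum : Summable u := by
    refine Summable.abs ?_
    rw [← summable_nat_add_iff 1]
    simp_rw [key]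
    exact ha'.shift.summable M
  have hd := hasDerivAt_tsum_of_isPreconnected (𝕜 := ℝ) (F := ℝ) (t := Metric.ball (0 : ℝ) M) (y₀ := 0) (y := y)
    (g := fun (k : ℕ) z => a k * (z ^ k / k.factorial))
    (g' := fun (k : ℕ) z => a k * ((k : ℝ) * z ^ (k - 1) / k.factorial)) husum
    Metric.isOpen_ball (convex_ball _ _).isPreconnected
    (fun k z _ => ((hasDerivAt_pow k z).div_const _).const_mul _)
    (fun k z hz => ?_) (by simp [hM]; positivity) (ha'.summable 0) (by simp [hM])
  · refine hd.congr_deriv ?_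
    rw [Summable.tsum_eq_zero_add]
    · simp only [key]
      simp [expGen]
    · rw [← summable_nat_add_iff 1]
      simp_rw [key]
      exact ha'.shift.summable y
  · have hz' : |z| ≤ |M| := by
      rw [Metric.mem_ball, dist_zero_right, Real.norm_eq_abs] at hz
      exact hz.le.trans (le_abs_self _)
    simp only [hu, Real.norm_eq_abs, abs_mul, abs_div, abs_pow]
    gcongr

lemma GeomBdd.hasSum {a : ℕ → ℝ} (ha : GeomBdd a) (y : ℝ) :
    HasSum (fun k : ℕ => a k * (y ^ k / k.factorial)) (expGen a y) := (ha.summable y).hasSum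

lemma GeomBdd.hasSum_mul {a : ℕ → ℝ} (ha : GeomBdd a) (y : ℝ) :
    HasSum (fun k : ℕ => k * a (k - 1) * (y ^ k / k.factorial)) (y * expGen a y) := by
  rw [← hasSum_nat_add_iff' 1]
  simp only [Finset.range_one, Finset.sum_singleton, Nat.cast_zero, zero_mul, sub_zero,
    Nat.add_sub_cancel]
  refine ((ha.hasSum y).mul_left y).congr_fun fun k => ?_
  rw [← succ_mul_pow_div_factorial y k]
  push_cast
  ring

/-- The action of `D2` on `e^{-nx} ∑ a_k (nx)^k / k!`. -/
lemma D2_exp_mul_expGen {a : ℕ → ℝ} (ha : GeomBdd a) (n : ℝ) (j : ℤ) (x : ℝ) :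
    D2 j (fun x => exp (-n * x) * expGen a (n * x)) x =
      exp (-n * x) * expGen (fun k => n * (((k : ℝ) + 1 - j) * a (k + 1)
        - (2 * k + 1 - j) * a k + k * a (k - 1))) (n * x) := by
  have hexp : ∀ x : ℝ, HasDerivAt (fun x => exp (-n * x)) (exp (-n * x) * (-n)) x := fun x => by
    simpa using ((hasDerivAt_id x).const_mul (-n)).exp
  have hgen : ∀ {b : ℕ → ℝ}, GeomBdd b → ∀ x : ℝ, HasDerivAt (fun x => expGen b (n * x))
      (expGen (fun k => b (k + 1)) (n * x) * n) x := fun hb x => by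
    have h1 := (hasDerivAt_id x).const_mul n
    simp only [id, mul_one] at h1
    exact (hasDerivAt_expGen hb (n * x)).comp x h1
  have hprod : ∀ {b : ℕ → ℝ}, GeomBdd b → ∀ x : ℝ,
      HasDerivAt (fun x => exp (-n * x) * expGen b (n * x))
        (n * (exp (-n * x) * expGen (fun k => b (k + 1)) (n * x)
          - exp (-n * x) * expGen b (n * x))) x := fun hb x => by
    refine ((hexp x).mul (hgen hb x)).congr_deriv ?_
    ring
  have hd1 : deriv (fun x => exp (-n * x) * expGen a (n * x)) =
      fun x => n * (exp (-n * x) * expGen (fun k => a (k + 1)) (n * x)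
          - exp (-n * x) * expGen a (n * x)) := funext fun x => (hprod ha x).deriv
  have hd2 := (((hprod ha.shift x).sub (hprod ha x)).const_mul n).deriv
  rw [D2, hd1]
  simp only [Pi.sub_def] at hd2
  rw [hd2]
  have hs := ((((ha.shift.hasSum (n * x)).sub (ha.hasSum (n * x))).mul_left (1 - (j : ℝ))).add
    (((ha.shift.shift.hasSum_mul (n * x)).sub ((ha.shift.hasSum_mul (n * x)).mul_left 2)).add
      (ha.hasSum_mul (n * x)))).mul_left n
  conv_rhs => rw [expGen]
  refine Eq.trans ?_ (congrArg (exp (-n * x) * ·) (hs.congr_fun fun k => ?_).tsum_eq.symm)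
  · ring
  · rcases k with _ | k
    · simp only [Nat.cast_zero]
      ring
    · simp only [Nat.add_sub_cancel]
      push_cast
      ring

lemma szk_natCast_s6 (n : ℝ) (m : ℕ) (x : ℝ) :
    szk n m x = (n * x) ^ m / m.factorial * exp (-n * x) := by
  simp [szk]

lemma szk_of_neg {k : ℤ} (hk : k < 0) (n x : ℝ) : szk n k x = 0 := by
  simp [szk, hk]

lemma hasDerivAt_szk (n : ℝ) (m : ℕ) (t : ℝ) :
    HasDerivAt (szk n m) (n * (szk n (m - 1) t - szk n m t)) t := by
  have hexp : HasDerivAt (fun x => exp (-n * x)) (exp (-n * t) * (-n)) t := by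
    simpa using ((hasDerivAt_id t).const_mul (-n)).exp
  have hlin : HasDerivAt (fun x => n * x) n t := by
    simpa using (hasDerivAt_id t).const_mul n
  rw [show szk n m = fun x => (n * x) ^ m / m.factorial * exp (-n * x) from
    funext (szk_natCast_s6 n m)]
  refine (((hlin.pow m).div_const _).mul hexp).congr_deriv ?_
  rcases m with _ | m
  · rw [szk_of_neg (by simp)]
    simp
    ring
  · rw [show ((m + 1 : ℕ) : ℤ) - 1 = m by push_cast; ring, szk_natCast_s6]
    rw [← succ_mul_pow_div_factorial]
    simp only [Nat.add_sub_cancel, Pi.pow_apply]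
    push_cast
    ring

lemma mul_szk (n : ℝ) (m : ℕ) (t : ℝ) :
    n * t * szk n m t = (m + 1) * szk n (m + 1) t := by
  rw [show (m : ℤ) + 1 = (m + 1 : ℕ) by push_cast; ring, szk_natCast_s6, szk_natCast_s6,
    ← succ_mul_pow_div_factorial (n * t) m]
  ring

lemma mul_szk_sub_one (n : ℝ) (m : ℕ) (t : ℝ) :
    n * t * szk n (m - 1) t = m * szk n m t := by
  rcases m with _ | m
  · rw [szk_of_neg (by simp)]
    simp
  · have := mul_szk n m t
    rw [show ((m + 1 : ℕ) : ℤ) - 1 = m by push_cast; ring, this]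
    push_cast
    rfl

lemma szk_nonneg {n t : ℝ} (hn : 0 ≤ n) (ht : 0 ≤ t) (k : ℤ) : 0 ≤ szk n k t := by
  unfold szk
  split_ifs
  · exact le_rfl
  · positivity

lemma szk_le {n t : ℝ} (hn : 0 ≤ n) (ht : 0 ≤ t) (k : ℤ) :
    szk n k t ≤ 4 ^ k.toNat * exp (-(3 / 4 * n) * t) := by
  unfold szk
  split_ifs
  · positivity
  · have h := Real.pow_div_factorial_le_exp (n * t / 4) (by positivity) k.toNat
    calc (n * t) ^ k.toNat / (k.toNat.factorial) * exp (-n * t)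
        = 4 ^ k.toNat * ((n * t / 4) ^ k.toNat / (k.toNat.factorial) * exp (-n * t)) := by
          rw [div_pow]; field_simp
      _ ≤ 4 ^ k.toNat * (exp (n * t / 4) * exp (-n * t)) := by gcongr
      _ = _ := by rw [← exp_add]; ring_nf

lemma abs_szk_mul_le {A K n t y : ℝ} (hn : 0 ≤ n) (hA : 4 * A ≤ n) (ht : 0 ≤ t) (k : ℤ)
    (hy : |y| ≤ K * exp (A * t)) :
    |szk n k t * y| ≤ K * 4 ^ k.toNat * exp (-(n / 2) * t) := by
  have hK : 0 ≤ K := by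
    by_contra! h
    exact absurd ((abs_nonneg y).trans hy) (not_le.2 (mul_neg_of_neg_of_pos h (exp_pos _)))
  rw [abs_mul, abs_of_nonneg (szk_nonneg hn ht k)]
  calc szk n k t * |y| ≤ 4 ^ k.toNat * exp (-(3 / 4 * n) * t) * (K * exp (A * t)) :=
        mul_le_mul (szk_le hn ht k) hy (abs_nonneg _) (by positivity)
    _ = K * 4 ^ k.toNat * exp (-(3 / 4 * n) * t + A * t) := by rw [exp_add]; ring
    _ ≤ _ := by
        gcongr
        nlinarith

lemma continuous_szk (n : ℝ) (k : ℤ) : Continuous (szk n k) := by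
  unfold szk
  split_ifs <;> fun_prop

lemma tendsto_szk_mul {A K n : ℝ} {h : ℝ → ℝ} (hn : 0 < n) (hA : 4 * A ≤ n) (k : ℤ)
    (hh : ∀ t ≥ 0, |h t| ≤ K * exp (A * t)) :
    Tendsto (fun t => szk n k t * h t) atTop (nhds 0) := by
  have hlim : Tendsto (fun t => K * 4 ^ k.toNat * exp (-(n / 2) * t)) atTop (nhds 0) := by
    have := (tendsto_exp_atBot.comp (tendsto_id.const_mul_atTop_of_neg
      (show -(n / 2) < 0 by linarith))).const_mul (K * 4 ^ k.toNat)
    simpa using this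
  refine squeeze_zero_norm' ?_ hlim
  filter_upwards [eventually_ge_atTop 0] with t ht
  exact abs_szk_mul_le hn.le hA ht k (hh t ht)

lemma integrableOn_szk_mul {A K n : ℝ} {h : ℝ → ℝ} (hn : 0 < n) (hA : 4 * A ≤ n) (k : ℤ)
    (hm : LocallyIntegrableOn h (Set.Ici 0) volume) (hh : ∀ t ≥ 0, |h t| ≤ K * exp (A * t)) :
    IntegrableOn (fun t => szk n k t * h t) (Set.Ioi 0) := by
  refine Integrable.mono' ((integrableOn_exp_mul_Ioi (show -(n / 2) < 0 by linarith) 0).const_mul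
    (K * 4 ^ k.toNat)) ?_ ?_
  · exact (continuous_szk n k).aestronglyMeasurable.mul
      (hm.aestronglyMeasurable.mono_set Set.Ioi_subset_Ici_self)
  · filter_upwards [ae_restrict_mem measurableSet_Ioi] with t ht
    exact abs_szk_mul_le hn.le hA (le_of_lt ht) k (hh t (le_of_lt ht))

lemma abs_integral_szk_mul_le {A K n : ℝ} {h : ℝ → ℝ} (hn : 0 < n) (hA : 4 * A ≤ n) (k : ℤ)
    (hh : ∀ t ≥ 0, |h t| ≤ K * exp (A * t)) :
    |n * ∫ t in Set.Ioi (0 : ℝ), szk n k t * h t| ≤ 2 * K * 4 ^ k.toNat := by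
  have hneg : -(n / 2) < 0 := by linarith
  have hle := norm_integral_le_of_norm_le ((integrableOn_exp_mul_Ioi hneg 0).const_mul
    (K * 4 ^ k.toNat)) (f := fun t => szk n k t * h t) (by
      filter_upwards [ae_restrict_mem measurableSet_Ioi] with t ht
      exact abs_szk_mul_le hn.le hA (le_of_lt ht) k (hh t (le_of_lt ht)))
  rw [integral_const_mul, integral_exp_mul_Ioi hneg, Real.norm_eq_abs] at hle
  rw [abs_mul, abs_of_pos hn]
  refine (mul_le_mul_of_nonneg_left hle hn.le).trans_eq ?_
  simp
  field_simp

/-- The coefficients of `Snj n j f` with respect to the basis functions `szk n k`. -/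
noncomputable def coeffSnj (n : ℝ) (j : ℤ) (f : ℝ → ℝ) (k : ℕ) : ℝ :=
  if (k : ℤ) < j then f 0 else n * ∫ t in Set.Ioi (0 : ℝ), szk n (k - j) t * f t

lemma geomBdd_coeffSnj {A K n : ℝ} {f : ℝ → ℝ} (hn : 0 < n) (hA : 4 * A ≤ n) (j : ℤ)
    (hf : ∀ t ≥ 0, |f t| ≤ K * exp (A * t)) : GeomBdd (coeffSnj n j f) := by
  have hK : |f 0| ≤ K := by simpa using hf 0 le_rfl
  have hK0 : 0 ≤ K := (abs_nonneg _).trans hK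
  refine ⟨2 * K * 4 ^ j.natAbs, 4, by positivity, by norm_num, fun k => ?_⟩
  unfold coeffSnj
  split_ifs
  · have h1 : (1 : ℝ) ≤ 4 ^ j.natAbs := one_le_pow₀ (by norm_num)
    have h2 : (1 : ℝ) ≤ 4 ^ k := one_le_pow₀ (by norm_num)
    have h3 : (1 : ℝ) ≤ 4 ^ j.natAbs * 4 ^ k := one_le_mul_of_one_le_of_one_le h1 h2
    nlinarith
  · refine (abs_integral_szk_mul_le hn hA _ hf).trans ?_
    rw [mul_assoc _ (4 ^ j.natAbs), ← pow_add]
    gcongr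
    · norm_num
    · omega

lemma Snj_eq_expGen {n : ℝ} {j : ℤ} {f : ℝ → ℝ} (h : GeomBdd (coeffSnj n j f)) (x : ℝ) :
    Snj n j f x = exp (-n * x) * expGen (coeffSnj n j f) (n * x) := by
  have hterm : ∀ k : ℕ, exp (-n * x) * (coeffSnj n j f k * ((n * x) ^ k / k.factorial))
      = szk n k x * coeffSnj n j f k := fun k => by rw [szk_natCast_s6]; ring
  have hs := (h.summable (n * x)).mul_left (exp (-n * x))
  rw [expGen, ← tsum_mul_left, ← hs.sum_add_tsum_nat_add j.toNat, Snj, Finset.mul_sum]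
  congr 1
  · refine Finset.sum_congr rfl fun k hk => ?_
    rw [hterm, coeffSnj, if_pos (by rw [Finset.mem_range] at hk; omega), mul_comm]
  · refine tsum_congr fun k => ?_
    rw [hterm, coeffSnj, if_neg (by omega),
      show ((k + j.toNat : ℕ) : ℤ) = max 0 j + k by push_cast; omega]

lemma abs_le_exp_of_deriv_le {A K : ℝ} {g g' : ℝ → ℝ} (hA : 0 < A)
    (hg : ∀ t, HasDerivAt g (g' t) t) (hb : ∀ t ≥ 0, |g' t| ≤ K * exp (A * t)) :
    ∀ t ≥ 0, |g t| ≤ (K / A + |g 0|) * exp (A * t) := by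
  intro t ht
  have hK0 : 0 ≤ K := by simpa using (abs_nonneg _).trans (hb 0 le_rfl)
  have hB : ∀ x, HasDerivAt (fun x => K / A * exp (A * x) + |g 0|) (K * exp (A * x)) x := fun x => by
    refine (((((hasDerivAt_id x).const_mul A).exp).const_mul (K / A)).add_const _).congr_deriv ?_
    simp only [id]
    field_simp
  have h := image_norm_le_of_norm_deriv_right_le_deriv_boundary (a := 0) (b := t) (f := g) (f' := g')
    (fun x _ => (hg x).continuousAt.continuousWithinAt) (fun x _ => (hg x).hasDerivWithinAt)
    (by simp; positivity) hB (fun x hx => hb x hx.1) (Set.right_mem_Icc.2 ht)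
  refine (Real.norm_eq_abs _ ▸ h).trans ?_
  have h1 : 1 ≤ exp (A * t) := one_le_exp (by positivity)
  nlinarith [abs_nonneg (g 0)]

/-- Integration by parts against a basis function: `szk n m` paired with `D2 j f`. -/
lemma integral_szk_mul_D2 {A K₁ K₂ n : ℝ} {f : ℝ → ℝ} (hA : 0 < A) (hn : 4 * A ≤ n) (j : ℤ)
    (hd1 : Differentiable ℝ f) (hd2 : Differentiable ℝ (deriv f))
    (hf : ∀ t ≥ 0, |f t| ≤ K₁ * exp (A * t)) (hDl : LocallyIntegrableOn (D2 j f) (Set.Ici 0) volume)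
    (hDf : ∀ t ≥ 0, |D2 j f t| ≤ K₂ * exp (A * t)) (m : ℕ) :
    ∫ t in Set.Ioi (0 : ℝ), szk n m t * D2 j f t =
      j * szk n m 0 * f 0 + n * ((m + j) * (∫ t in Set.Ioi (0 : ℝ), szk n (m - 1) t * f t)
        - (2 * m + 1 + j) * (∫ t in Set.Ioi (0 : ℝ), szk n m t * f t)
        + (m + 1) * ∫ t in Set.Ioi (0 : ℝ), szk n (m + 1) t * f t) := by
  have hn0 : 0 < n := by linarith
  set g : ℝ → ℝ := fun t => t * deriv f t - j * f t with hgdef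
  have hg : ∀ t, HasDerivAt g (D2 j f t) t := fun t => by
    refine (((hasDerivAt_id t).mul (hd2 t).hasDerivAt).sub
      ((hd1 t).hasDerivAt.const_mul (j : ℝ))).congr_deriv ?_
    simp only [D2, id]
    ring
  have hgb := abs_le_exp_of_deriv_le hA hg hDf
  have hfl : LocallyIntegrableOn f (Set.Ici 0) volume :=
    hd1.continuous.locallyIntegrable.locallyIntegrableOn _
  have hint := fun k : ℤ => integrableOn_szk_mul hn0 hn k hfl hf
  have hintD := integrableOn_szk_mul hn0 hn m hDl hDf
  have hF : ∀ t, HasDerivAt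
      (fun t => szk n m t * g t - (m * (szk n m t * f t) - (m + 1) * (szk n (m + 1) t * f t)))
      (szk n m t * D2 j f t - n * ((m + j) * (szk n (m - 1) t * f t)
        - (2 * m + 1 + j) * (szk n m t * f t) + (m + 1) * (szk n (m + 1) t * f t))) t := fun t => by
    have hs := hasDerivAt_szk n m t
    have hs1 := hasDerivAt_szk n (m + 1) t
    rw [show ((m + 1 : ℕ) : ℤ) - 1 = m by push_cast; ring,
      show ((m + 1 : ℕ) : ℤ) = m + 1 by push_cast; ring] at hs1
    have hft := (hd1 t).hasDerivAt
    refine ((hs.mul (hg t)).sub (((hs.mul hft).const_mul (m : ℝ)).sub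
      ((hs1.mul hft).const_mul ((m : ℝ) + 1)))).congr_deriv ?_
    have e1 := mul_szk n m t
    have e2 := mul_szk_sub_one n m t
    simp only [hgdef]
    linear_combination deriv f t * e2 - deriv f t * e1
  have hlim := ((tendsto_szk_mul hn0 hn m hgb).sub
    (((tendsto_szk_mul hn0 hn m hf).const_mul (m : ℝ)).sub
      ((tendsto_szk_mul hn0 hn (m + 1) hf).const_mul ((m : ℝ) + 1))))
  have hintS : IntegrableOn (fun t => (m + j) * (szk n (m - 1) t * f t)
        - (2 * m + 1 + j) * (szk n m t * f t)) (Set.Ioi 0) :=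
    ((hint _).const_mul _).sub ((hint _).const_mul _)
  have hintR : IntegrableOn (fun t => n * ((m + j) * (szk n (m - 1) t * f t)
        - (2 * m + 1 + j) * (szk n m t * f t) + (m + 1) * (szk n (m + 1) t * f t))) (Set.Ioi 0) :=
    (hintS.add ((hint _).const_mul _)).const_mul _
  have h := integral_Ioi_of_hasDerivAt_of_tendsto' (fun t _ => hF t) (hintD.sub hintR) hlim
  rw [integral_sub hintD hintR, integral_const_mul, integral_add hintS ((hint _).const_mul _),
    integral_sub ((hint _).const_mul _) ((hint _).const_mul _), integral_const_mul,
    integral_const_mul, integral_const_mul] at h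
  have z1 : szk n (m + 1) 0 = 0 := by
    have := mul_szk n m 0
    simp only [mul_zero, zero_mul] at this
    exact (mul_eq_zero.1 this.symm).resolve_left (by positivity)
  have z2 := mul_szk_sub_one n m 0
  simp only [mul_zero, zero_mul] at z2
  simp only [hgdef, z1] at h
  linear_combination h - f 0 * z2

lemma coeffSnj_D2 {A K₁ K₂ n : ℝ} {f : ℝ → ℝ} (hA : 0 < A) (hn : 4 * A ≤ n) (j : ℤ)
    (hd1 : Differentiable ℝ f) (hd2 : Differentiable ℝ (deriv f))
    (hf : ∀ t ≥ 0, |f t| ≤ K₁ * exp (A * t)) (hDl : LocallyIntegrableOn (D2 j f) (Set.Ici 0) volume)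
    (hDf : ∀ t ≥ 0, |D2 j f t| ≤ K₂ * exp (A * t)) (h0 : 2 ≤ j → deriv f 0 = 0) (k : ℕ) :
    coeffSnj n j (D2 j f) k = n * (((k : ℝ) + 1 - j) * coeffSnj n j f (k + 1)
      - (2 * k + 1 - j) * coeffSnj n j f k + k * coeffSnj n j f (k - 1)) := by
  rcases lt_or_ge (k : ℤ) j with hk | hk
  · have hD0 : D2 j f 0 = 0 := by
      rcases lt_or_ge j 2 with h2 | h2
      · obtain rfl : j = 1 := by omega
        simp [D2]
      · simp [D2, h0 h2]
    have e1 : ((k : ℝ) + 1 - j) * coeffSnj n j f (k + 1) = (k + 1 - j) * f 0 := by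
      rcases lt_or_ge ((k : ℤ) + 1) j with h1 | h1
      · rw [coeffSnj, if_pos (by push_cast; omega)]
      · have : (k : ℝ) + 1 - j = 0 := by
          have : (k : ℤ) + 1 - j = 0 := by omega
          exact_mod_cast this
        simp [this]
    rw [e1]
    simp only [coeffSnj]
    rw [if_pos hk, if_pos hk, if_pos (by omega), hD0]
    ring
  · obtain ⟨m, hm⟩ := Int.eq_ofNat_of_zero_le (sub_nonneg.2 hk)
    have hj : (j : ℝ) = k - m := by
      have : j = k - m := by omega
      rw [this]; push_cast; ring
    have h := integral_szk_mul_D2 hA hn j hd1 hd2 hf hDl hDf m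
    have e0 : (k : ℝ) * coeffSnj n j f (k - 1) =
        j * szk n m 0 * f 0 + k * (n * ∫ t in Set.Ioi (0 : ℝ), szk n (m - 1) t * f t) := by
      rcases Nat.eq_zero_or_pos k with rfl | hk0
      · rcases Nat.eq_zero_or_pos m with rfl | hm0
        · simp [hj]
        · rw [szk_natCast_s6]
          simp [hm0.ne']
      · rcases Nat.eq_zero_or_pos m with rfl | hm0
        · rw [coeffSnj, if_pos (by omega), szk_natCast_s6]
          simp only [szk_of_neg (show ((0 : ℕ) : ℤ) - 1 < 0 by simp)]
          simp [hj]
        · rw [coeffSnj, if_neg (by omega), show ((k - 1 : ℕ) : ℤ) - j = m - 1 by omega, szk_natCast_s6]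
          simp [hm0.ne']
    rw [e0]
    simp only [coeffSnj]
    rw [if_neg (by omega), if_neg (by omega), if_neg (by omega), hm,
      show ((k + 1 : ℕ) : ℤ) - j = m + 1 by push_cast; omega]
    rw [h, hj]
    ring

/-- `S_{n,j}` and `D_j²` commute for sufficiently large `n`. -/
theorem commute_Snj_D2 (j : ℤ) (f : ℝ → ℝ)
    (hd1 : Differentiable ℝ f) (hd2 : Differentiable ℝ (deriv f))
    (hf : ∃ A ≥ (0:ℝ), MemEA A f) (hDf : ∃ A ≥ (0:ℝ), MemEA A (D2 j f))
    (h0 : 2 ≤ j → deriv f 0 = 0) :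
    ∃ N : ℝ, ∀ n > N, ∀ x ≥ (0:ℝ), Snj n j (D2 j f) x = D2 j (Snj n j f) x := by
  obtain ⟨A₁, hA₁, -, K₁, hK₁, hb₁⟩ := hf
  obtain ⟨A₂, hA₂, hDl, K₂, hK₂, hb₂⟩ := hDf
  set A := A₁ + A₂ + 1 with hAdef
  have hA : 0 < A := by positivity
  have hf' : ∀ t ≥ 0, |f t| ≤ K₁ * exp (A * t) := fun t ht => (hb₁ t ht).trans (by
    gcongr; linarith)
  have hDf' : ∀ t ≥ 0, |D2 j f t| ≤ K₂ * exp (A * t) := fun t ht => (hb₂ t ht).trans (by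
    gcongr; linarith)
  refine ⟨4 * A, fun n hn x _ => ?_⟩
  have hn0 : 0 < n := by linarith
  have hG := geomBdd_coeffSnj hn0 hn.le j hf'
  rw [Snj_eq_expGen (geomBdd_coeffSnj hn0 hn.le j hDf'), funext (Snj_eq_expGen hG),
    D2_exp_mul_expGen hG]
  rw [funext (coeffSnj_D2 hA hn.le j hd1 hd2 hf' hDl hDf' h0)]
end
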